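/- For every probability distribution P on 𝒳, every ν ≥ 0, and every probability distribution p_Y on 𝒴, the function E ↦ G^{(ν)}(E, p_Y|P) := max_{q ∈ 𝒫(𝒳): D(q‖P) ≤ E} [ −∑_x q(x) log ∑_y p_Y(y) e^{−ν d(x,y)} ] is monotone non-decreasing and concave on E ≥ 0. -/

import Mathlib

open scoped BigOperators

/-- `p` is a probability distribution on the finite set `X`. -/
def IsDist {X : Type*} [Fintype X] (p : X → ℝ) : Prop :=
  (∀ x, 0 ≤ p x) ∧ ∑ x, p x = 1

/-- `V` is a conditional probability distribution on `Y` given `X`. -/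
def IsCondDist {X Y : Type*} [Fintype Y] (V : X → Y → ℝ) : Prop :=
  ∀ x, IsDist (V x)

/-- Mutual information `I(q,V)` with the convention `0 log 0 = 0`. -/
noncomputable def mutInfo {X Y : Type*} [Fintype X] [Fintype Y]
    (q : X → ℝ) (V : X → Y → ℝ) : ℝ :=
  ∑ x, ∑ y, if q x * V x y = 0 then 0
    else q x * V x y * Real.log (V x y / ∑ x', q x' * V x' y)

/-- The rate-distortion function `R(Δ|q)`. -/
noncomputable def rateDist {X Y : Type*} [Fintype X] [Fintype Y]
    (d : X → Y → ℝ) (Δ : ℝ) (q : X → ℝ) : ℝ :=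
  sInf { r | ∃ V : X → Y → ℝ, IsCondDist V ∧
    (∑ x, ∑ y, q x * V x y * d x y) ≤ Δ ∧ r = mutInfo q V }

/-- Relative entropy `D(q‖P)` (real-valued; convention `0 log 0 = 0`). -/
noncomputable def relEnt {X : Type*} [Fintype X] (q P : X → ℝ) : ℝ :=
  ∑ x, if q x = 0 then 0 else q x * Real.log (q x / P x)

/-- Absolute continuity: `q(x) = 0` whenever `P(x) = 0` (finiteness of `D(q‖P)`). -/
def AbsCont {X : Type*} (q P : X → ℝ) : Prop := ∀ x, P x = 0 → q x = 0
/-- The value function of maximizing `f` over `s` under the constraint `D ≤ E` is monotone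
in `E`. -/
theorem monotoneOn_sSup_of_constraint {V : Type*} {s : Set V} {D f : V → ℝ} {t : Set ℝ}
    (hne : ∀ E ∈ t, ∃ q ∈ s, D q ≤ E) (hbdd : BddAbove (f '' s)) :
    MonotoneOn (fun E : ℝ => sSup (f '' {q ∈ s | D q ≤ E})) t := by
  intro a ha b _ hab
  obtain ⟨q, hq, hqa⟩ := hne a ha
  exact csSup_le_csSup (hbdd.mono (Set.image_mono fun _ h => h.1)) ⟨f q, q, ⟨hq, hqa⟩, rfl⟩
    (Set.image_mono fun _ h => ⟨h.1, h.2.trans hab⟩)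

/-- The value function of maximizing a concave function `f` under the convex constraint `D ≤ E`
is concave in `E`. -/
theorem concaveOn_sSup_of_constraint {V : Type*} [AddCommGroup V] [Module ℝ V] {s : Set V}
    {D f : V → ℝ} {t : Set ℝ} (ht : Convex ℝ t) (hD : ConvexOn ℝ s D) (hf : ConcaveOn ℝ s f)
    (hne : ∀ E ∈ t, ∃ q ∈ s, D q ≤ E) (hbdd : BddAbove (f '' s)) :
    ConcaveOn ℝ t (fun E : ℝ => sSup (f '' {q ∈ s | D q ≤ E})) := by
  have hne' : ∀ E ∈ t, (f '' {q ∈ s | D q ≤ E}).Nonempty := fun E hE => by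
    obtain ⟨q, hq⟩ := hne E hE
    exact ⟨f q, q, hq, rfl⟩
  refine ⟨ht, fun E₁ h₁ E₂ h₂ a b ha hb hab => le_of_forall_pos_lt_add fun ε hε => ?_⟩
  obtain ⟨_, ⟨q₁, ⟨hq₁, hD₁⟩, rfl⟩, hv₁⟩ := exists_lt_of_lt_csSup (hne' E₁ h₁) (sub_lt_self _ hε)
  obtain ⟨_, ⟨q₂, ⟨hq₂, hD₂⟩, rfl⟩, hv₂⟩ := exists_lt_of_lt_csSup (hne' E₂ h₂) (sub_lt_self _ hε)
  have hmem : a • q₁ + b • q₂ ∈ {q ∈ s | D q ≤ a • E₁ + b • E₂} := by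
    refine ⟨hD.1 hq₁ hq₂ ha hb hab, (hD.2 hq₁ hq₂ ha hb hab).trans ?_⟩
    simp only [smul_eq_mul]
    gcongr
  have hle := le_csSup (hbdd.mono (Set.image_mono fun _ h => h.1)) (Set.mem_image_of_mem f hmem)
  have hconc := hf.2 hq₁ hq₂ ha hb hab
  simp only [smul_eq_mul] at hle hconc ⊢
  obtain rfl : b = 1 - a := by linarith
  rcases ha.eq_or_lt with rfl | ha
  · linarith
  · nlinarith [mul_lt_mul_of_pos_left hv₁ ha, mul_le_mul_of_nonneg_left hv₂.le hb]

/-- The distributions absolutely continuous with respect to `P` form a convex set. -/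
theorem convex_setOf_isDist_absCont {X : Type*} [Fintype X] (P : X → ℝ) :
    Convex ℝ {q : X → ℝ | IsDist q ∧ AbsCont q P} := by
  rintro q ⟨⟨hq0, hq1⟩, hqP⟩ r ⟨⟨hr0, hr1⟩, hrP⟩ a b ha hb hab
  refine ⟨⟨fun x => ?_, ?_⟩, fun x hx => ?_⟩
  · exact add_nonneg (mul_nonneg ha (hq0 x)) (mul_nonneg hb (hr0 x))
  · simp [Finset.sum_add_distrib, ← Finset.mul_sum, hq1, hr1, hab]
  · simp [hqP x hx, hrP x hx]

theorem relEnt_eq_sum_of_absCont {X : Type*} [Fintype X] {q P : X → ℝ} (h : AbsCont q P) :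
    relEnt q P = ∑ x, (q x * Real.log (q x) - q x * Real.log (P x)) := by
  refine Finset.sum_congr rfl fun x _ => ?_
  split_ifs with hx
  · simp [hx]
  · rw [Real.log_div hx (mt (h x) hx), mul_sub]

/-- Relative entropy is convex in its first argument. -/
theorem convexOn_relEnt {X : Type*} [Fintype X] (P : X → ℝ) :
    ConvexOn ℝ {q : X → ℝ | IsDist q ∧ AbsCont q P} (fun q => relEnt q P) := by
  have hS := convex_setOf_isDist_absCont P
  refine ⟨hS, fun q hq r hr a b ha hb hab => ?_⟩
  simp only [relEnt_eq_sum_of_absCont (hS hq hr ha hb hab).2, relEnt_eq_sum_of_absCont hq.2,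
    relEnt_eq_sum_of_absCont hr.2, smul_eq_mul, Finset.mul_sum, ← Finset.sum_add_distrib]
  refine Finset.sum_le_sum fun x _ => ?_
  have h := Real.convexOn_mul_log.2 (hq.1.1 x) (hr.1.1 x) ha hb hab
  simp only [smul_eq_mul, Pi.add_apply, Pi.smul_apply] at h ⊢
  linarith

theorem relEnt_self {X : Type*} [Fintype X] (P : X → ℝ) : relEnt P P = 0 := by
  refine Finset.sum_eq_zero fun x _ => ?_
  split_ifs with hx
  · rfl
  · simp [div_self hx]

/-- The expectation of a function on a finite set is bounded over all distributions. -/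
theorem IsDist.sum_mul_le {X : Type*} [Fintype X] {q : X → ℝ} (hq : IsDist q) (c : X → ℝ) :
    ∑ x, q x * c x ≤ ∑ x, |c x| := by
  refine Finset.sum_le_sum fun x _ => ?_
  have h1 : q x ≤ 1 := hq.2 ▸ Finset.single_le_sum (fun i _ => hq.1 i) (Finset.mem_univ x)
  calc q x * c x ≤ q x * |c x| := mul_le_mul_of_nonneg_left (le_abs_self _) (hq.1 x)
    _ ≤ |c x| := mul_le_of_le_one_left (abs_nonneg _) h1

/-- Property 2: `E ↦ G^{(ν)}(E,p_Y|P)` is monotone non-decreasing and concave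
on `E ≥ 0`. -/
theorem G_nu_monotone_concave
    {X Y : Type*} [Fintype X] [Fintype Y] [Nonempty X] [Nonempty Y]
    (P : X → ℝ) (hP : IsDist P)
    (d : X → Y → ℝ) (hd : ∀ x y, 0 ≤ d x y)
    (ν : ℝ) (hν : 0 ≤ ν) (pY : Y → ℝ) (hpY : IsDist pY) :
    MonotoneOn (fun E : ℝ => sSup { v | ∃ q : X → ℝ, IsDist q ∧ AbsCont q P ∧
        relEnt q P ≤ E ∧
        v = -∑ x, q x * Real.log (∑ y, pY y * Real.exp (-ν * d x y)) })
      (Set.Ici (0 : ℝ)) ∧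
    ConcaveOn ℝ (Set.Ici (0 : ℝ))
      (fun E : ℝ => sSup { v | ∃ q : X → ℝ, IsDist q ∧ AbsCont q P ∧
        relEnt q P ≤ E ∧
        v = -∑ x, q x * Real.log (∑ y, pY y * Real.exp (-ν * d x y)) }) := by
  let c : X → ℝ := fun x => Real.log (∑ y, pY y * Real.exp (-ν * d x y))
  let f : (X → ℝ) → ℝ := fun q => -∑ x, q x * c x
  let s : Set (X → ℝ) := {q | IsDist q ∧ AbsCont q P}
  have hG : (fun E : ℝ => sSup (f '' {q ∈ s | relEnt q P ≤ E})) =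
      fun E : ℝ => sSup {v | ∃ q : X → ℝ, IsDist q ∧ AbsCont q P ∧ relEnt q P ≤ E ∧
        v = -∑ x, q x * c x} := by
    funext E
    congr 1
    ext v
    simp only [s, f, Set.mem_ofPred_eq, Set.mem_image, and_assoc, eq_comm]
  have hne : ∀ E ∈ Set.Ici (0 : ℝ), ∃ q ∈ s, relEnt q P ≤ E := fun E hE =>
    ⟨P, ⟨hP, fun _ h => h⟩, (relEnt_self P).trans_le hE⟩
  have hbdd : BddAbove (f '' s) := by
    refine ⟨∑ x, |(-c) x|, ?_⟩
    rintro _ ⟨q, hq, rfl⟩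
    simpa [f] using hq.1.sum_mul_le (-c)
  have hf : ConcaveOn ℝ s f := by
    refine ⟨convex_setOf_isDist_absCont P, fun q _ r _ a b _ _ _ => le_of_eq ?_⟩
    simp only [f, smul_eq_mul, Pi.add_apply, Pi.smul_apply, add_mul, Finset.sum_add_distrib,
      mul_assoc, ← Finset.mul_sum]
    ring
  have hmono := monotoneOn_sSup_of_constraint hne hbdd
  have hconc := concaveOn_sSup_of_constraint (convex_Ici 0) (convexOn_relEnt P) hf hne hbdd
  rw [hG] at hmono hconc
  exact ⟨hmono, hconc⟩
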